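/- arXiv:2107.11590 — 2 statements merged into one kernel-verified Lean document; each statement's English description precedes it below -/
import Mathlib

section
/- Let q : ℝ^n → ℝ be a polynomial of degree at most 2 such that ∫_{ℝ^n \ B_1} |x|^σ e^{q(x)} dx < ∞ for some σ > -n. Then there exists ε > 0 such that ∫_{ℝ^n \ B_1} |x|^{σ+ε} e^{q(x)} dx < ∞. -/
open MeasureTheory Real

lemma aux_exp_lower (s δ : ℝ) (hδ : 0 < δ) : ∃ c > 0, ∀ t : ℝ, 1 ≤ t → c ≤ t ^ s * exp (δ * t) := by
  have hm : 0 ≤ |s| := abs_nonneg s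
  set m := |s|
  set a := δ / (m + 1) with ha
  have ha0 : 0 < a := by positivity
  refine ⟨exp (m * (1 + log a)), exp_pos _, fun t ht => ?_⟩
  have ht0 : 0 < t := by linarith
  have h1 : log (a * t) ≤ a * t - 1 := log_le_sub_one_of_pos (by positivity)
  rw [log_mul ha0.ne' ht0.ne'] at h1
  have hlt : 0 ≤ log t := log_nonneg ht
  have hs : -m ≤ s := neg_abs_le s
  rw [rpow_def_of_pos ht0, ← exp_add]
  apply exp_le_exp.mpr
  have h2 : m * log t ≤ m * (a * t - 1 - log a) := mul_le_mul_of_nonneg_left (by linarith) hm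
  have h3 : -(m * log t) ≤ log t * s := by nlinarith
  have h4 : m * a ≤ δ := by
    have : (m + 1) * a = δ := by rw [ha]; field_simp
    nlinarith
  have h5 : m * a * t ≤ δ * t := mul_le_mul_of_nonneg_right h4 ht0.le
  nlinarith

lemma aux_box (l b t : ℝ) (ht : |t| ≤ 2) : exp (-(4 * |l| + 2 * |b|)) ≤ exp (l * t ^ 2 + b * t) := by
  apply exp_le_exp.mpr
  have h1 : |l * t ^ 2| ≤ |l| * 4 := by
    rw [abs_mul]
    apply mul_le_mul_of_nonneg_left _ (abs_nonneg _)
    rw [abs_pow]; nlinarith [abs_nonneg t]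
  have h2 : |b * t| ≤ |b| * 2 := by
    rw [abs_mul]
    exact mul_le_mul_of_nonneg_left ht (abs_nonneg _)
  linarith [neg_abs_le (l * t ^ 2), neg_abs_le (b * t)]

lemma aux_good {n : ℕ} (N : (Fin n → ℝ) → ℝ) (C : ℝ) (hC : 1 ≤ C) (h1 : ∀ x, ‖x‖ ≤ N x)
    (h2 : ∀ x, N x ≤ C * ‖x‖) (lam bet : Fin n → ℝ) (σ : ℝ)
    (hint : IntegrableOn (fun x => N x ^ σ * ∏ i, exp (lam i * x i ^ 2 + bet i * x i)) {x | 1 ≤ N x})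
    (i : Fin n) : lam i < 0 ∨ (lam i = 0 ∧ bet i = 0) := by
  by_contra hcon
  have hl : 0 ≤ lam i := by
    by_contra h; exact hcon (Or.inl (not_le.mp h))
  have hδ : 0 < lam i + |bet i| := by
    rcases hl.lt_or_eq with h | h
    · positivity
    · have : bet i ≠ 0 := fun hb => hcon (Or.inr ⟨h.symm, hb⟩)
      positivity
  obtain ⟨s, hs, hsb⟩ : ∃ s : ℝ, (s = 1 ∨ s = -1) ∧ bet i * s = |bet i| := by
    rcases le_total 0 (bet i) with h | h
    · exact ⟨1, Or.inl rfl, by rw [abs_of_nonneg h]; ring⟩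
    · exact ⟨-1, Or.inr rfl, by rw [abs_of_nonpos h]; ring⟩
  have hs2 : s * s = 1 := by rcases hs with h | h <;> rw [h] <;> norm_num
  obtain ⟨c, hc, hcle⟩ := aux_exp_lower (-|σ|) _ hδ
  set c0 : ℝ := ∏ j ∈ Finset.univ.erase i, exp (-(4 * |lam j| + 2 * |bet j|)) with hc0
  have hc0p : 0 < c0 := Finset.prod_pos fun _ _ => exp_pos _
  set K : Set (Fin n → ℝ) := Set.pi Set.univ (fun j => if j = i then {t | 1 ≤ s * t} else Set.Icc 1 2) with hK
  have hKi : ∀ x ∈ K, 1 ≤ s * x i := fun x hx => by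
    have := hx i trivial; simpa using this
  have hKj : ∀ x ∈ K, ∀ j ≠ i, 1 ≤ x j ∧ x j ≤ 2 := fun x hx j hj => by
    have := hx j trivial; simpa [hj] using this
  have habs : ∀ x ∈ K, |x i| = s * x i := fun x hx => by
    have := hKi x hx
    rcases hs with h | h <;> rw [h] at this ⊢
    · rw [abs_of_nonneg (by linarith)]; ring
    · rw [abs_of_nonpos (by linarith)]; ring
  have hNlow : ∀ x ∈ K, 1 ≤ N x := fun x hx =>
    calc (1:ℝ) ≤ |x i| := by rw [habs x hx]; exact hKi x hx
      _ ≤ ‖x‖ := norm_le_pi_norm x i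
      _ ≤ N x := h1 x
  have hKm : MeasurableSet K := by
    apply MeasurableSet.univ_pi
    intro j
    split_ifs
    · exact measurableSet_le measurable_const (by fun_prop)
    · exact measurableSet_Icc
  have hint' := hint.mono_set (show K ⊆ {x | 1 ≤ N x} from hNlow)
  have hlow : ∀ x ∈ K, (2 * C) ^ (-|σ|) * (c * c0) ≤ N x ^ σ * ∏ i, exp (lam i * x i ^ 2 + bet i * x i) := by
    intro x hx
    have hu := hKi x hx
    set u := s * x i with hudef
    have hxi : x i = s * u := by rw [hudef, ← mul_assoc, hs2, one_mul]
    have hn1 := hNlow x hx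
    have hxn : ‖x‖ ≤ 2 * u := by
      rw [pi_norm_le_iff_of_nonneg (by linarith)]
      intro j
      by_cases hj : j = i
      · rw [hj, Real.norm_eq_abs, habs x hx]; linarith
      · have := hKj x hx j hj
        rw [Real.norm_eq_abs, abs_of_nonneg (by linarith)]; linarith
    have hn2 : N x ≤ (2 * C) * u := (h2 x).trans (by nlinarith)
    have hp1 : (2 * C) ^ (-|σ|) * u ^ (-|σ|) ≤ N x ^ σ := by
      rw [← mul_rpow (by linarith) (by linarith)]
      calc _ ≤ N x ^ (-|σ|) := rpow_le_rpow_of_nonpos (by linarith) hn2 (by simp)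
        _ ≤ _ := rpow_le_rpow_of_exponent_le hn1 (neg_abs_le _)
    have hp2 : c0 ≤ ∏ j ∈ Finset.univ.erase i, exp (lam j * x j ^ 2 + bet j * x j) := by
      apply Finset.prod_le_prod
      · intros; positivity
      · intro j hj
        have := hKj x hx j (Finset.ne_of_mem_erase hj)
        exact aux_box _ _ _ (by rw [abs_of_nonneg (by linarith)]; linarith)
    have hp3 : exp ((lam i + |bet i|) * u) ≤ exp (lam i * x i ^ 2 + bet i * x i) := by
      apply exp_le_exp.mpr
      have e1 : x i ^ 2 = u ^ 2 := by rw [hxi, mul_pow, sq s, hs2, one_mul]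
      have e2 : bet i * x i = |bet i| * u := by rw [hxi, ← hsb]; ring
      rw [e1, e2]
      have : lam i * u ≤ lam i * u ^ 2 := mul_le_mul_of_nonneg_left (by nlinarith) hl
      linarith
    rw [← Finset.mul_prod_erase _ _ (Finset.mem_univ i)]
    have hp4 := hcle u hu
    calc (2 * C) ^ (-|σ|) * (c * c0)
        ≤ (2 * C) ^ (-|σ|) * ((u ^ (-|σ|) * exp ((lam i + |bet i|) * u)) * c0) := by gcongr
      _ = ((2 * C) ^ (-|σ|) * u ^ (-|σ|)) * (exp ((lam i + |bet i|) * u) * c0) := by ring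
      _ ≤ _ := by gcongr
  have hcst : 0 < (2 * C) ^ (-|σ|) * (c * c0) := by positivity
  have hfin : IntegrableOn (fun _ : Fin n → ℝ => (2 * C) ^ (-|σ|) * (c * c0)) K := by
    refine Integrable.mono' hint' (by fun_prop) ?_
    filter_upwards [ae_restrict_mem hKm] with x hx
    rw [Real.norm_eq_abs, abs_of_pos hcst]
    exact hlow x hx
  rw [integrableOn_const_iff] at hfin
  rcases hfin with h | h
  · rw [enorm_eq_zero] at h; exact hcst.ne' h
  · rw [hK, volume_pi_pi, ← Finset.mul_prod_erase _ _ (Finset.mem_univ i)] at h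
    have e1 : ∏ j ∈ Finset.univ.erase i, volume (if j = i then {t : ℝ | 1 ≤ s * t} else Set.Icc 1 2) = 1 := by
      apply Finset.prod_eq_one
      intro j hj
      rw [if_neg (Finset.ne_of_mem_erase hj), Real.volume_Icc]; norm_num
    have e2 : volume {t : ℝ | 1 ≤ s * t} = ⊤ := by
      rcases hs with h | h
      · rw [show {t : ℝ | 1 ≤ s * t} = Set.Ici 1 by ext; simp [h], Real.volume_Ici]
      · rw [show {t : ℝ | 1 ≤ s * t} = Set.Iic (-1) by ext; simp [h, le_neg], Real.volume_Iic]
    rw [e1, if_pos rfl, e2] at h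
    simp at h

lemma aux_gauss (l b : ℝ) (hl : l < 0) : Integrable (fun t : ℝ => exp (l * t ^ 2 + b * t)) := by
  have := (integrable_cexp_quadratic' (b := (l : ℂ)) (by simpa using hl) (b : ℂ) 0).norm
  refine this.congr (Filter.Eventually.of_forall fun t => ?_)
  simp only [Complex.norm_exp]
  congr 1
  norm_cast
  simp

lemma aux_gauss_abs (l b m : ℝ) (hl : l < 0) (hm : 0 ≤ m) :
    Integrable (fun t : ℝ => exp (m * |t|) * exp (l * t ^ 2 + b * t)) := by
  refine Integrable.mono' ((aux_gauss l (b + m) hl).add (aux_gauss l (b - m) hl))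
    (by fun_prop) (Filter.Eventually.of_forall fun t => ?_)
  rw [Real.norm_eq_abs, abs_of_pos (by positivity), ← exp_add]
  simp only [Pi.add_apply]
  rcases le_total 0 t with h | h
  · rw [abs_of_nonneg h, show m * t + (l * t ^ 2 + b * t) = l * t ^ 2 + (b + m) * t by ring]
    linarith [exp_pos (l * t ^ 2 + (b - m) * t)]
  · rw [abs_of_nonpos h, show m * -t + (l * t ^ 2 + b * t) = l * t ^ 2 + (b - m) * t by ring]
    linarith [exp_pos (l * t ^ 2 + (b + m) * t)]

lemma aux_neg {n : ℕ} (N : (Fin n → ℝ) → ℝ) (hN : Measurable N) (C : ℝ) (hC : 1 ≤ C)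
    (h2 : ∀ x, N x ≤ C * ‖x‖) (lam bet : Fin n → ℝ) (σ : ℝ) (hl : ∀ i, lam i < 0) :
    IntegrableOn (fun x => N x ^ σ * ∏ i, exp (lam i * x i ^ 2 + bet i * x i)) {x | 1 ≤ N x} := by
  have hm : 0 ≤ |σ| * C := by positivity
  have hI : Integrable (fun x : Fin n → ℝ =>
      ∏ i, (exp ((|σ| * C) * |x i|) * exp (lam i * x i ^ 2 + bet i * x i))) :=
    Integrable.fintype_prod
      (f := fun i t => exp ((|σ| * C) * |t|) * exp (lam i * t ^ 2 + bet i * t))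
      (fun i => aux_gauss_abs (lam i) (bet i) _ (hl i) hm)
  refine Integrable.mono' hI.integrableOn (by fun_prop) ?_
  filter_upwards [ae_restrict_mem (measurableSet_le measurable_const hN)] with x hx
  have hx : 1 ≤ N x := hx
  have hp : 0 < ∏ i, exp (lam i * x i ^ 2 + bet i * x i) := Finset.prod_pos fun _ _ => exp_pos _
  rw [Real.norm_eq_abs, abs_of_nonneg (by positivity), Finset.prod_mul_distrib]
  refine mul_le_mul_of_nonneg_right ?_ hp.le
  rw [← exp_sum, ← Finset.mul_sum]
  have hs : ‖x‖ ≤ ∑ i, |x i| := by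
    rw [pi_norm_le_iff_of_nonneg (Finset.sum_nonneg fun _ _ => abs_nonneg _)]
    intro j
    exact Finset.single_le_sum (f := fun i => |x i|) (fun _ _ => abs_nonneg _) (Finset.mem_univ j)
  rw [rpow_def_of_pos (by linarith)]
  apply exp_le_exp.mpr
  have h3 : log (N x) ≤ N x := (log_le_sub_one_of_pos (by linarith)).trans (by linarith)
  have h4 : 0 ≤ log (N x) := log_nonneg hx
  calc log (N x) * σ ≤ log (N x) * |σ| := mul_le_mul_of_nonneg_left (le_abs_self _) h4
    _ ≤ N x * |σ| := by gcongr
    _ ≤ (C * ‖x‖) * |σ| := by gcongr; exact h2 x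
    _ ≤ (C * ∑ i, |x i|) * |σ| := by gcongr
    _ = _ := by ring

lemma aux_radial {ι : Type*} [Fintype ι] [Nonempty ι] (σ : ℝ)
    (h : IntegrableOn (fun y : ι → ℝ => ‖y‖ ^ σ) {y | 1 ≤ ‖y‖}) : σ < -(Fintype.card ι : ℝ) := by
  have hm : MeasurableSet {y : ι → ℝ | 1 ≤ ‖y‖} := measurableSet_le measurable_const measurable_norm
  rw [← integrable_indicator_iff hm] at h
  have h' : Integrable (fun y : ι → ℝ => (Set.Ici (1:ℝ)).indicator (fun r => r ^ σ) ‖y‖) := by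
    refine h.congr (Filter.Eventually.of_forall fun y => ?_)
    simp [Set.indicator]
  rw [integrable_fun_norm_addHaar] at h'
  have h3 := h'.mono_set (Set.Ioi_subset_Ioi (zero_le_one' ℝ))
  have hk : 1 ≤ Fintype.card ι := Fintype.card_pos
  have h4 : IntegrableOn (fun r : ℝ => r ^ (((Fintype.card ι : ℝ) - 1) + σ)) (Set.Ioi 1) := by
    refine h3.congr_fun (fun r hr => ?_) measurableSet_Ioi
    have hr : 1 < r := hr
    simp only [Module.finrank_pi, smul_eq_mul]
    rw [Set.indicator_of_mem (show r ∈ Set.Ici (1:ℝ) from hr.le), rpow_add (by linarith),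
      ← rpow_natCast, Nat.cast_sub hk, Nat.cast_one]
  rw [integrableOn_Ioi_rpow_iff one_pos] at h4
  linarith

lemma aux_lower {n : ℕ} (N : (Fin n → ℝ) → ℝ) (C : ℝ) (hC : 1 ≤ C) (h1 : ∀ x, ‖x‖ ≤ N x)
    (h2 : ∀ x, N x ≤ C * ‖x‖) (lam bet : Fin n → ℝ) (σ : ℝ) (p : Fin n → Prop) [DecidablePred p]
    (hp : ∀ i, p i → lam i = 0 ∧ bet i = 0) [Nonempty (Subtype p)]
    (hint : IntegrableOn (fun x => N x ^ σ * ∏ i, exp (lam i * x i ^ 2 + bet i * x i)) {x | 1 ≤ N x}) :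
    σ < -(Fintype.card (Subtype p) : ℝ) := by
  apply aux_radial
  set e := MeasurableEquiv.piEquivPiSubtypeProd (fun _ : Fin n => ℝ) p with he
  have hpres := volume_preserving_piEquivPiSubtypeProd (fun _ : Fin n => ℝ) p
  set A : Set (Subtype p → ℝ) := {y | 1 ≤ ‖y‖} with hA
  set B : Set ({i // ¬ p i} → ℝ) := Set.pi Set.univ (fun _ => Set.Icc 0 1) with hB
  have hAm : MeasurableSet A := measurableSet_le measurable_const measurable_norm
  have hBm : MeasurableSet B := MeasurableSet.univ_pi fun _ => measurableSet_Icc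
  have hsub : ∀ x ∈ e ⁻¹' (A ×ˢ B), 1 ≤ ‖(e x).1‖ ∧ ‖x‖ = ‖(e x).1‖ ∧ ∀ i, |x i| ≤ 2 ∨ p i := by
    rintro x ⟨hx1, hx2⟩
    have hx1 : 1 ≤ ‖(e x).1‖ := hx1
    have hb : ∀ i, ¬ p i → |x i| ≤ 1 := fun i hi => by
      have : x i ∈ Set.Icc (0:ℝ) 1 := hx2 ⟨i, hi⟩ trivial
      rw [abs_of_nonneg this.1]; exact this.2
    refine ⟨hx1, le_antisymm ?_ ?_, ?_⟩
    · rw [pi_norm_le_iff_of_nonneg (by linarith)]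
      intro j
      by_cases hj : p j
      · exact norm_le_pi_norm (e x).1 ⟨j, hj⟩
      · exact (hb j hj).trans hx1
    · rw [pi_norm_le_iff_of_nonneg (norm_nonneg _)]
      intro j
      exact norm_le_pi_norm x j
    · intro i
      by_cases hi : p i
      · exact Or.inr hi
      · exact Or.inl ((hb i hi).trans (by norm_num))
  have hm : MeasurableSet (e ⁻¹' (A ×ˢ B)) := e.measurable (hAm.prod hBm)
  have hint' := hint.mono_set (show e ⁻¹' (A ×ˢ B) ⊆ {x | 1 ≤ N x} from fun x hx => by
    obtain ⟨a, b, _⟩ := hsub x hx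
    exact a.trans (b ▸ h1 x))
  set c0 : ℝ := ∏ j, exp (-(4 * |lam j| + 2 * |bet j|)) with hc0
  have hc0p : 0 < c0 := Finset.prod_pos fun _ _ => exp_pos _
  have hc1 : 0 < C ^ (-|σ|) := by positivity
  have hI1 : IntegrableOn (fun x => ‖(e x).1‖ ^ σ) (e ⁻¹' (A ×ˢ B)) := by
    refine Integrable.mono' (hint'.const_mul ((C ^ (-|σ|) * c0)⁻¹))
      ((e.measurable.fst.norm.pow_const σ).aestronglyMeasurable) ?_
    filter_upwards [ae_restrict_mem hm] with x hx
    obtain ⟨a, b, d⟩ := hsub x hx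
    rw [Real.norm_eq_abs, abs_of_nonneg (by positivity), ← div_eq_inv_mul, le_div_iff₀ (by positivity)]
    have hp2 : c0 ≤ ∏ j, exp (lam j * x j ^ 2 + bet j * x j) := by
      apply Finset.prod_le_prod
      · intros; positivity
      · intro j _
        rcases d j with h | h
        · exact aux_box _ _ _ h
        · obtain ⟨u, v⟩ := hp j h
          simp [u, v]
    have hn1 := h1 x
    have hn2 := h2 x
    rw [b] at hn1 hn2
    set r := ‖(e x).1‖
    have hp1 : C ^ (-|σ|) * r ^ σ ≤ N x ^ σ := by
      rcases le_total 0 σ with h | h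
      · calc C ^ (-|σ|) * r ^ σ ≤ 1 * r ^ σ := by
              gcongr
              exact rpow_le_one_of_one_le_of_nonpos hC (by simp)
          _ ≤ _ := by rw [one_mul]; exact rpow_le_rpow (by linarith) hn1 h
      · rw [abs_of_nonpos h, neg_neg, ← mul_rpow (by linarith) (by linarith)]
        exact rpow_le_rpow_of_nonpos (by linarith) hn2 h
    have hN0 : 0 ≤ N x ^ σ := rpow_nonneg (by linarith) _
    calc r ^ σ * (C ^ (-|σ|) * c0) = (C ^ (-|σ|) * r ^ σ) * c0 := by ring
      _ ≤ _ := by gcongr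
  have hI2 : IntegrableOn (fun z : (Subtype p → ℝ) × ({i // ¬ p i} → ℝ) => ‖z.1‖ ^ σ) (A ×ˢ B) :=
    (hpres.integrableOn_comp_preimage e.measurableEmbedding).mp hI1
  rw [IntegrableOn, Measure.volume_eq_prod, ← Measure.prod_restrict] at hI2
  have hI3 := hI2.prod_left_ae
  have hne : (volume.restrict B) ≠ 0 := by
    rw [Ne, Measure.restrict_eq_zero, hB, volume_pi_pi]
    simp
  have : (ae (volume.restrict B)).NeBot := ae_neBot.mpr hne
  obtain ⟨z, hz⟩ := hI3.exists
  exact hz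

lemma aux_upper {n : ℕ} (N : (Fin n → ℝ) → ℝ) (hN : Measurable N) (h1 : ∀ x, ‖x‖ ≤ N x)
    (lam bet : Fin n → ℝ) (σ : ℝ) (p : Fin n → Prop) [DecidablePred p]
    (hp : ∀ i, p i → lam i = 0 ∧ bet i = 0) (hnp : ∀ i, ¬ p i → lam i < 0)
    (hσ : σ < -(Fintype.card (Subtype p) : ℝ)) :
    IntegrableOn (fun x => N x ^ σ * ∏ i, exp (lam i * x i ^ 2 + bet i * x i)) {x | 1 ≤ N x} := by
  set e := MeasurableEquiv.piEquivPiSubtypeProd (fun _ : Fin n => ℝ) p with he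
  have hpres := volume_preserving_piEquivPiSubtypeProd (fun _ : Fin n => ℝ) p
  have hσ0 : σ ≤ 0 := hσ.le.trans (by simp)
  have i1 : Integrable (fun y : Subtype p → ℝ => (1 + ‖y‖) ^ (-(-σ))) :=
    integrable_one_add_norm (by rw [Module.finrank_pi]; linarith)
  have i2 : Integrable (fun z : {i // ¬ p i} → ℝ => ∏ i : {i // ¬ p i}, exp (lam i * z i ^ 2 + bet i * z i)) :=
    Integrable.fintype_prod (f := fun (i : {i // ¬ p i}) t => exp (lam i * t ^ 2 + bet i * t))
      (fun i => aux_gauss _ _ (hnp i i.2))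
  have i3 := i1.mul_prod i2
  rw [← Measure.volume_eq_prod] at i3
  have i4 := (hpres.integrable_comp_emb e.measurableEmbedding).mpr i3
  refine Integrable.mono' ((i4.const_mul ((2:ℝ) ^ (-σ))).integrableOn) (by fun_prop) ?_
  filter_upwards [ae_restrict_mem (measurableSet_le measurable_const hN)] with x hx
  have hx : 1 ≤ N x := hx
  have hpp : 0 < ∏ i, exp (lam i * x i ^ 2 + bet i * x i) := Finset.prod_pos fun _ _ => exp_pos _
  rw [Real.norm_eq_abs, abs_of_nonneg (by positivity)]
  have e1 : ∏ i, exp (lam i * x i ^ 2 + bet i * x i)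
      = ∏ i : {i // ¬ p i}, exp (lam i * (e x).2 i ^ 2 + bet i * (e x).2 i) := by
    rw [← Fintype.prod_subtype_mul_prod_subtype p]
    rw [Finset.prod_eq_one, one_mul]
    · rfl
    · intro i _
      obtain ⟨u, v⟩ := hp i i.2
      simp [u, v]
  have e2 : ‖(e x).1‖ ≤ ‖x‖ := by
    rw [pi_norm_le_iff_of_nonneg (norm_nonneg _)]
    intro j
    exact norm_le_pi_norm x j
  have e3 : N x ^ σ ≤ (2:ℝ) ^ (-σ) * (1 + ‖(e x).1‖) ^ (-(-σ)) := by
    have : (1 + ‖(e x).1‖) / 2 ≤ N x := by linarith [h1 x]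
    calc N x ^ σ ≤ ((1 + ‖(e x).1‖) / 2) ^ σ := rpow_le_rpow_of_nonpos (by positivity) this hσ0
      _ = _ := by
        rw [div_rpow (by positivity) (by norm_num), rpow_neg (by norm_num), neg_neg]
        field_simp
  show _ ≤ (2:ℝ) ^ (-σ) * ((1 + ‖(e x).1‖) ^ (-(-σ)) * ∏ i : {i // ¬ p i}, exp (lam i * (e x).2 i ^ 2 + bet i * (e x).2 i))
  rw [← e1, ← mul_assoc]
  exact mul_le_mul_of_nonneg_right e3 hpp.le

lemma aux_core {n : ℕ} (N : (Fin n → ℝ) → ℝ) (hN : Measurable N) (C : ℝ) (hC : 1 ≤ C)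
    (h1 : ∀ x, ‖x‖ ≤ N x)
    (h2 : ∀ x, N x ≤ C * ‖x‖) (lam bet : Fin n → ℝ) (σ : ℝ)
    (hint : IntegrableOn (fun x => N x ^ σ * ∏ i, exp (lam i * x i ^ 2 + bet i * x i)) {x | 1 ≤ N x}) :
    ∃ ε > 0, IntegrableOn (fun x => N x ^ (σ + ε) * ∏ i, exp (lam i * x i ^ 2 + bet i * x i))
      {x | 1 ≤ N x} := by
  classical
  have hg := aux_good N C hC h1 h2 lam bet σ hint
  by_cases hall : ∀ i, lam i < 0
  · exact ⟨1, one_pos, aux_neg N hN C hC h2 lam bet _ hall⟩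
  · push Not at hall
    obtain ⟨i0, hi0⟩ := hall
    have hp : ∀ i, ¬ lam i < 0 → lam i = 0 ∧ bet i = 0 := fun i hi => (hg i).resolve_left hi
    haveI : Nonempty (Subtype fun i => ¬ lam i < 0) := ⟨⟨i0, not_lt.mpr hi0⟩⟩
    have hs := aux_lower N C hC h1 h2 lam bet σ (fun i => ¬ lam i < 0) hp hint
    refine ⟨(-(Fintype.card (Subtype fun i => ¬ lam i < 0) : ℝ) - σ) / 2, by linarith, ?_⟩
    exact aux_upper N hN h1 lam bet _ (fun i => ¬ lam i < 0) hp (fun i hi => not_not.mp hi) (by linarith)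

lemma aux_quad {n : ℕ} (Q : MvPolynomial (Fin n) ℝ) (hdeg : Q.totalDegree ≤ 2) :
    ∃ (A : Fin n → Fin n → ℝ) (b : Fin n → ℝ) (c : ℝ), ∀ x : Fin n → ℝ,
      MvPolynomial.eval x Q = ∑ i, ∑ j, A i j * (x i * x j) + ∑ i, b i * x i + c := by
  have key : ∀ s : Finset (Fin n →₀ ℕ), s ⊆ Q.support →
      ∃ (A : Fin n → Fin n → ℝ) (b : Fin n → ℝ) (c : ℝ), ∀ x : Fin n → ℝ,
      ∑ d ∈ s, MvPolynomial.coeff d Q * ∏ i, x i ^ d i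
        = ∑ i, ∑ j, A i j * (x i * x j) + ∑ i, b i * x i + c := by
    intro s
    induction s using Finset.induction_on with
    | empty => intro _; exact ⟨0, 0, 0, by simp⟩
    | insert d s hd ih =>
      intro hs
      obtain ⟨A, b, c, h⟩ := ih (fun x hx => hs (Finset.mem_insert_of_mem hx))
      have hd2 : d.degree ≤ 2 := by
        have := MvPolynomial.le_totalDegree (hs (Finset.mem_insert_self d s))
        exact (show d.degree ≤ _ from this).trans hdeg
      have hmon : d = 0 ∨ (∃ i, d = Finsupp.single i 1) ∨
          ∃ i j, d = Finsupp.single i 1 + Finsupp.single j 1 := by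
        have step : ∀ d : Fin n →₀ ℕ, d ≠ 0 → ∃ i d', d = Finsupp.single i 1 + d' ∧ d.degree = d'.degree + 1 := by
          intro d hd
          obtain ⟨i, hi⟩ := Finsupp.ne_iff.mp hd
          have hle : Finsupp.single i 1 ≤ d := by
            rw [Finsupp.single_le_iff]; exact Nat.one_le_iff_ne_zero.mpr hi
          have e : d = Finsupp.single i 1 + (d - Finsupp.single i 1) := (add_tsub_cancel_of_le hle).symm
          refine ⟨i, _, e, ?_⟩
          conv_lhs => rw [e]
          rw [map_add, Finsupp.degree_single, add_comm]
        by_cases h0 : d = 0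
        · exact Or.inl h0
        obtain ⟨i, d', e, hdd⟩ := step d h0
        by_cases h1 : d' = 0
        · exact Or.inr (Or.inl ⟨i, by rw [e, h1, add_zero]⟩)
        obtain ⟨j, d'', e', hdd'⟩ := step d' h1
        have h2 : d'' = 0 := by
          rw [← Finsupp.degree_eq_zero_iff]; omega
        exact Or.inr (Or.inr ⟨i, j, by rw [e, e', h2, add_zero]⟩)
      have hsing : ∀ (i : Fin n) (x : Fin n → ℝ), ∏ k, x k ^ (Finsupp.single i 1 : Fin n →₀ ℕ) k = x i := by
        intro i x
        rw [Finset.prod_eq_single i]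
        · simp
        · intro k _ hk; simp [Finsupp.single_apply, hk.symm]
        · simp
      set a := MvPolynomial.coeff d Q with ha
      rcases hmon with h0 | ⟨i, h0⟩ | ⟨i, j, h0⟩
      · refine ⟨A, b, c + a, fun x => ?_⟩
        rw [Finset.sum_insert hd, h x, ← ha, h0]
        simp; ring
      · refine ⟨A, fun k => b k + if k = i then a else 0, c, fun x => ?_⟩
        rw [Finset.sum_insert hd, h x, ← ha, h0, hsing]
        simp [add_mul, Finset.sum_add_distrib]; ring
      · refine ⟨fun k l => A k l + if k = i then (if l = j then a else 0) else 0, b, c, fun x => ?_⟩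
        rw [Finset.sum_insert hd, h x, ← ha, h0]
        simp only [Finsupp.add_apply, pow_add, Finset.prod_mul_distrib, hsing]
        simp [add_mul, Finset.sum_add_distrib]; ring
  obtain ⟨A, b, c, h⟩ := key Q.support (Finset.Subset.refl _)
  exact ⟨A, b, c, fun x => by rw [MvPolynomial.eval_eq']; exact h x⟩

lemma aux_diag {n : ℕ} (Q : MvPolynomial (Fin n) ℝ) (hdeg : Q.totalDegree ≤ 2) :
    ∃ (U : EuclideanSpace ℝ (Fin n) ≃ₗᵢ[ℝ] EuclideanSpace ℝ (Fin n)) (lam bet : Fin n → ℝ) (c : ℝ),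
      ∀ y : EuclideanSpace ℝ (Fin n), MvPolynomial.eval (fun i => (U y) i) Q =
        ∑ i, (lam i * y i ^ 2 + bet i * y i) + c := by
  obtain ⟨A, b, c, h⟩ := aux_quad Q hdeg
  set M : Matrix (Fin n) (Fin n) ℝ := fun i j => (A i j + A j i) / 2 with hM
  have hMs : M.IsHermitian := by
    ext i j; rw [Matrix.conjTranspose_apply, star_trivial]; simp only [hM]; ring
  have hT : (Matrix.toEuclideanLin M).IsSymmetric := Matrix.isSymmetric_toEuclideanLin_iff.mpr hMs
  have hfr : Module.finrank ℝ (EuclideanSpace ℝ (Fin n)) = n := by simp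
  set v := hT.eigenvectorBasis hfr with hv
  set lam := hT.eigenvalues hfr with hlam
  have hquad : ∀ x : EuclideanSpace ℝ (Fin n),
      ∑ i, ∑ j, A i j * (x i * x j) = inner ℝ x (Matrix.toEuclideanLin M x) := by
    intro x
    have e1 : inner ℝ x (Matrix.toEuclideanLin M x) = ∑ i, ∑ j, M i j * (x i * x j) := by
      simp only [PiLp.inner_apply, Matrix.toEuclideanLin_apply, Matrix.mulVec, dotProduct]
      refine Finset.sum_congr rfl fun i _ => ?_
      simp [Finset.sum_mul]
      exact Finset.sum_congr rfl fun j _ => by ring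
    rw [e1]
    have e2 : ∑ i, ∑ j, A j i * (x i * x j) = ∑ i, ∑ j, A i j * (x i * x j) := by
      rw [Finset.sum_comm]
      exact Finset.sum_congr rfl fun i _ => Finset.sum_congr rfl fun j _ => by ring
    have e3 : ∑ i, ∑ j, M i j * (x i * x j)
        = (∑ i, ∑ j, A i j * (x i * x j) + ∑ i, ∑ j, A j i * (x i * x j)) / 2 := by
      rw [← Finset.sum_add_distrib, Finset.sum_div]
      refine Finset.sum_congr rfl fun i _ => ?_
      rw [← Finset.sum_add_distrib, Finset.sum_div]
      exact Finset.sum_congr rfl fun j _ => by simp only [hM]; ring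
    rw [e3, e2]; ring
  refine ⟨v.repr.symm, lam, fun i => inner ℝ (WithLp.toLp 2 b) (v i), c, fun y => ?_⟩
  rw [h, hquad]
  set x := v.repr.symm y with hx
  have hy : ∀ i, inner ℝ (v i) x = y i := fun i => by
    rw [← OrthonormalBasis.repr_apply_apply, hx, LinearIsometryEquiv.apply_symm_apply]
  have e1 : inner ℝ x (Matrix.toEuclideanLin M x) = ∑ i, lam i * y i ^ 2 := by
    rw [← v.sum_inner_mul_inner]
    refine Finset.sum_congr rfl fun i _ => ?_
    rw [← hT (v i) x, hv, hT.apply_eigenvectorBasis hfr i, ← hv, real_inner_comm, hy, inner_smul_left, hy]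
    simp [hlam]; ring
  have e2 : ∑ i, b i * x i = ∑ i, inner ℝ (WithLp.toLp 2 b) (v i) * y i := by
    have : inner ℝ (WithLp.toLp 2 b) x = ∑ i, b i * x i := by
      simp [PiLp.inner_apply, mul_comm]
    rw [← this, ← v.sum_inner_mul_inner]
    exact Finset.sum_congr rfl fun i _ => by rw [hy]
  rw [e1, e2, Finset.sum_add_distrib]

theorem stmt_2 {n : ℕ} (hn : 1 ≤ n) (Q : MvPolynomial (Fin n) ℝ)
    (hdeg : Q.totalDegree ≤ 2) (σ : ℝ) (hσ : -(n : ℝ) < σ)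
    (hint : IntegrableOn
      (fun x : EuclideanSpace ℝ (Fin n) =>
        ‖x‖ ^ σ * Real.exp (MvPolynomial.eval (fun i => x i) Q))
      {x : EuclideanSpace ℝ (Fin n) | 1 ≤ ‖x‖}) :
    ∃ ε > 0, IntegrableOn
      (fun x : EuclideanSpace ℝ (Fin n) =>
        ‖x‖ ^ (σ + ε) * Real.exp (MvPolynomial.eval (fun i => x i) Q))
      {x : EuclideanSpace ℝ (Fin n) | 1 ≤ ‖x‖} := by
  obtain ⟨U, lam, bet, c, h⟩ := aux_diag Q hdeg
  set N : (Fin n → ℝ) → ℝ := fun x => ‖(WithLp.toLp 2 x : EuclideanSpace ℝ (Fin n))‖ with hNdef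
  have key : ∀ s : ℝ, IntegrableOn
      (fun x : EuclideanSpace ℝ (Fin n) => ‖x‖ ^ s * Real.exp (MvPolynomial.eval (fun i => x i) Q))
      {x : EuclideanSpace ℝ (Fin n) | 1 ≤ ‖x‖} ↔
      IntegrableOn (fun x => N x ^ s * ∏ i, exp (lam i * x i ^ 2 + bet i * x i)) {x | 1 ≤ N x} := by
    intro s
    rw [← U.measurePreserving.integrableOn_comp_preimage U.toHomeomorph.measurableEmbedding,
      ← (PiLp.volume_preserving_toLp (Fin n)).integrableOn_comp_preimage
        (MeasurableEquiv.toLp 2 (Fin n → ℝ)).measurableEmbedding]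
    have hset : (WithLp.toLp 2 : (Fin n → ℝ) → EuclideanSpace ℝ (Fin n)) ⁻¹'
        (U ⁻¹' {x : EuclideanSpace ℝ (Fin n) | 1 ≤ ‖x‖}) = {x | 1 ≤ N x} := by
      ext x; simp [hNdef]
    rw [hset]
    have hfun : (((fun x : EuclideanSpace ℝ (Fin n) => ‖x‖ ^ s * Real.exp (MvPolynomial.eval (fun i => x i) Q))
        ∘ U) ∘ (WithLp.toLp 2 : (Fin n → ℝ) → EuclideanSpace ℝ (Fin n))) =
        fun x => exp c * (N x ^ s * ∏ i, exp (lam i * x i ^ 2 + bet i * x i)) := by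
      funext x
      simp only [Function.comp, h, LinearIsometryEquiv.norm_map, hNdef, exp_add, exp_sum]
      ring
    rw [hfun]
    exact integrable_const_mul_iff (IsUnit.mk0 _ (exp_pos c).ne') _
  simp only [key] at hint ⊢
  obtain ⟨C, hC⟩ : ∃ C : ℝ, ∀ x, N x ≤ C * ‖x‖ :=
    ⟨_, (PiLp.continuousLinearEquiv 2 ℝ (fun _ : Fin n => ℝ)).symm.toContinuousLinearMap.le_opNorm⟩
  refine aux_core N ?_ (max C 1) (le_max_right _ _) ?_ ?_ lam bet σ hint
  · have : Continuous N := by simp only [hNdef]; fun_prop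
    exact this.measurable
  · intro x
    rw [pi_norm_le_iff_of_nonneg (norm_nonneg _)]
    intro i
    exact PiLp.norm_apply_le (WithLp.toLp 2 x : EuclideanSpace ℝ (Fin n)) i
  · intro x
    exact (hC x).trans (mul_le_mul_of_nonneg_right (le_max_left _ _) (norm_nonneg _))
end

section
/- Let p : ℝ^n → ℝ be a polynomial such that ∫_{ℝ^n} e^{p(x)} dx < ∞ and such that there exist s > 0 and a sequence x_k with |x_k| → ∞ and p(x_k) ≥ |x_k|^s. If moreover |∇p(y)| ≤ C|y|^{n-2} for all large |y|, then one obtains a contradiction; i.e., no such polynomial exists. Consequently, if p is a polynomial with deg p ≤ n-1, |∇p(y)| ≤ C|y|^{n-2} for large |y|, and ∫_{ℝ^n} e^{p} < ∞, then p is bounded from above. -/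
open MeasureTheory Real Filter

/-- Polynomial expressions in elements satisfying monic-type relations are integral. -/
lemma aux_integral {A B : Type*} [CommRing A] [CommRing B] [Algebra A B] {n m : ℕ}
    (x : Fin n → B) (q : Fin n → MvPolynomial (Fin n) A)
    (hq : ∀ i, (q i).totalDegree < m) (hx : ∀ i, x i ^ m = MvPolynomial.aeval x (q i))
    (f : MvPolynomial (Fin n) A) : IsIntegral A (MvPolynomial.aeval x f) := by
  classical
  set W : Submodule A B := (MvPolynomial.restrictTotalDegree (Fin n) A (n * m)).map
    (MvPolynomial.aeval x : MvPolynomial (Fin n) A →ₐ[A] B).toLinearMap with hW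
  have key : ∀ k : ℕ, ∀ g : MvPolynomial (Fin n) A, g.totalDegree ≤ k →
      MvPolynomial.aeval x g ∈ W := by
    intro k
    induction k using Nat.strong_induction_on with
    | _ k ih =>
    intro g hg
    by_cases hk : k ≤ n * m
    · exact ⟨g, (MvPolynomial.mem_restrictTotalDegree _ _ _).2 (hg.trans hk), rfl⟩
    rw [g.as_sum, map_sum]
    refine Submodule.sum_mem _ fun s hs => ?_
    have hs' : ∑ i, s i ≤ k := by
      have := (MvPolynomial.le_totalDegree hs).trans hg
      rwa [Finsupp.sum_fintype _ _ (fun _ => rfl)] at this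
    have deg_mon : ∀ (t : Fin n →₀ ℕ) (c : A),
        (MvPolynomial.monomial t c).totalDegree ≤ ∑ i, t i := by
      intro t c
      have := MvPolynomial.totalDegree_monomial_le t c
      rwa [Finsupp.sum_fintype _ _ (fun _ => rfl)] at this
    by_cases hlt : ∑ i, s i < k
    · exact ih _ hlt _ (deg_mon _ _)
    have hsum : ∑ i, s i = k := le_antisymm hs' (not_lt.1 hlt)
    obtain ⟨i, hi⟩ : ∃ i, m ≤ s i := by
      by_contra! hcon
      apply hk
      rw [← hsum]
      calc ∑ i, s i ≤ ∑ _i : Fin n, m := Finset.sum_le_sum fun i _ => (hcon i).le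
        _ = n * m := by simp
    set t : Fin n →₀ ℕ := s - Finsupp.single i m with ht
    have hst : s = t + Finsupp.single i m := by
      rw [ht, tsub_add_cancel_of_le]
      simpa using hi
    have hrep : MvPolynomial.aeval x (MvPolynomial.monomial s (g.coeff s))
        = MvPolynomial.aeval x (MvPolynomial.monomial t (g.coeff s) * q i) := by
      rw [map_mul, ← hx i, ← MvPolynomial.aeval_X (R := A) x i, ← map_pow, ← map_mul,
        MvPolynomial.X_pow_eq_monomial, MvPolynomial.monomial_mul, ← hst, mul_one]
    rw [hrep]
    have h1 : ∑ j, s j = ∑ j, t j + m := by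
      conv_lhs => rw [hst]
      simp [Finset.sum_add_distrib, Finsupp.single_apply]
    have h2 := MvPolynomial.totalDegree_mul (MvPolynomial.monomial t (g.coeff s)) (q i)
    have h3 := deg_mon t (g.coeff s)
    have h4 := hq i
    exact ih (∑ j, t j + (q i).totalDegree) (by omega) _ (by omega)
  have hrange : Subalgebra.toSubmodule (MvPolynomial.aeval x : MvPolynomial (Fin n) A →ₐ[A] B).range = W := by
    apply le_antisymm
    · rintro _ ⟨g, rfl⟩
      exact key _ g le_rfl
    · rintro _ ⟨g, _, rfl⟩
      exact ⟨g, rfl⟩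
  refine IsIntegral.of_mem_of_fg (MvPolynomial.aeval x : MvPolynomial (Fin n) A →ₐ[A] B).range
    ?_ _ ⟨f, rfl⟩
  rw [hrange]
  exact (Module.Finite.iff_fg.1 inferInstance).map _

lemma aux_hasDerivAt {n : ℕ} (P : MvPolynomial (Fin n) ℝ) (x : Fin n → ℝ) (i : Fin n) (τ : ℝ) :
    HasDerivAt (fun τ => MvPolynomial.eval (Function.update x i τ) P)
      (MvPolynomial.eval (Function.update x i τ) (MvPolynomial.pderiv i P)) τ := by
  classical
  induction P using MvPolynomial.induction_on with
  | C a => simpa using hasDerivAt_const τ a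
  | add p q hp hq => simp only [map_add]; exact hp.add hq
  | mul_X p j hp =>
    have hj : HasDerivAt (fun τ => Function.update x i τ j)
        (MvPolynomial.eval (Function.update x i τ) (MvPolynomial.pderiv i
          (MvPolynomial.X j : MvPolynomial (Fin n) ℝ))) τ := by
      by_cases h : j = i
      · subst h; simp only [Function.update_self, MvPolynomial.pderiv_X_self, map_one]; exact hasDerivAt_id' τ
      · simpa [h, MvPolynomial.pderiv_X_of_ne h] using hasDerivAt_const τ (x j)
    have := hp.mul hj
    simp only [Derivation.leibniz, smul_eq_mul, map_add, map_mul, MvPolynomial.eval_X]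
    rw [add_comm, mul_comm (Function.update x i τ j)]
    exact this

lemma aux_bound {n : ℕ} (P : MvPolynomial (Fin n) ℝ) :
    ∃ C : ℝ, 0 < C ∧ ∀ x : Fin n → ℝ,
      |MvPolynomial.eval x P| ≤ C * (max 1 ‖x‖) ^ P.totalDegree := by
  refine ⟨∑ s ∈ P.support, |P.coeff s| + 1, by positivity, fun x => ?_⟩
  have h1 : (1:ℝ) ≤ max 1 ‖x‖ := le_max_left _ _
  calc |MvPolynomial.eval x P| ≤ ∑ s ∈ P.support, |P.coeff s| * (max 1 ‖x‖) ^ P.totalDegree := by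
        rw [MvPolynomial.eval_eq']
        refine (Finset.abs_sum_le_sum_abs _ _).trans (Finset.sum_le_sum fun s hs => ?_)
        rw [abs_mul]
        gcongr
        rw [Finset.abs_prod]
        have hs' : ∑ i, s i ≤ P.totalDegree := by
          have := MvPolynomial.le_totalDegree hs
          rwa [Finsupp.sum_fintype _ _ (fun _ => rfl)] at this
        calc ∏ i, |x i ^ s i| ≤ ∏ i, (max 1 ‖x‖) ^ s i := by
              refine Finset.prod_le_prod (fun _ _ => abs_nonneg _) fun i _ => ?_
              rw [abs_pow]
              gcongr
              exact (norm_le_pi_norm x i).trans (le_max_right _ _)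
          _ = (max 1 ‖x‖) ^ (∑ i, s i) := Finset.prod_pow_eq_pow_sum _ _ _
          _ ≤ _ := pow_le_pow_right₀ h1 hs'
    _ = (∑ s ∈ P.support, |P.coeff s|) * (max 1 ‖x‖) ^ P.totalDegree := by
        rw [Finset.sum_mul]
    _ ≤ _ := by gcongr; linarith

lemma aux_pderiv_deg {n : ℕ} (P : MvPolynomial (Fin n) ℝ) (i : Fin n) :
    (MvPolynomial.pderiv i P).totalDegree ≤ P.totalDegree := by
  classical
  refine Finset.sup_le fun s hs => ?_
  have h : s + Finsupp.single i 1 ∈ P.support := by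
    rw [MvPolynomial.mem_support_iff] at hs ⊢
    intro h0
    apply hs
    rw [MvPolynomial.coeff_pderiv, h0]
    simp
  have := MvPolynomial.le_totalDegree h
  rw [Finsupp.sum_fintype _ _ (fun _ => rfl)] at this ⊢
  simp only [Finsupp.add_apply, Finset.sum_add_distrib] at this
  omega

lemma aux_poly_bound (q : Polynomial ℝ) :
    ∃ C : ℝ, 0 ≤ C ∧ ∀ D, q.natDegree ≤ D → ∀ T : ℝ, 1 ≤ T → |q.eval T| ≤ C * T ^ D := by
  refine ⟨∑ i ∈ Finset.range (q.natDegree + 1), |q.coeff i|, by positivity, fun D hD T hT => ?_⟩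
  rw [Polynomial.eval_eq_sum_range, Finset.sum_mul]
  refine (Finset.abs_sum_le_sum_abs _ _).trans (Finset.sum_le_sum fun i hi => ?_)
  rw [abs_mul, abs_pow, abs_of_nonneg (by linarith : (0:ℝ) ≤ T)]
  gcongr
  have := Finset.mem_range.1 hi; omega

lemma aux_poly_lower (q : Polynomial ℝ) (hq : q ≠ 0) :
    ∃ c : ℝ, 0 < c ∧ ∀ᶠ T in atTop, c ≤ |q.eval T| := by
  by_cases hd : 0 < q.degree
  · exact ⟨1, one_pos, (Polynomial.abs_tendsto_atTop q hd).eventually_ge_atTop 1⟩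
  · have h := Polynomial.eq_C_of_degree_le_zero (not_lt.1 hd)
    refine ⟨|q.coeff 0|, ?_, ?_⟩
    · rw [abs_pos]; intro h0; rw [h0] at h; exact hq (by simpa using h)
    · refine Eventually.of_forall fun T => ?_
      rw [h]; simp

/-- Algebraic growth. -/
lemma aux_growth (Q : Polynomial (Polynomial ℝ)) (hQ : Q ≠ 0) (T : ℕ → ℝ)
    (hT : Tendsto T atTop atTop)
    (h : ∀ k : ℕ, (Q.eval (Polynomial.C (k : ℝ))).eval (T k) = 0) :
    ∃ (K : ℝ) (D : ℕ), 0 < K ∧ ∀ᶠ k : ℕ in atTop, (k : ℝ) ≤ K * T k ^ D := by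
  obtain ⟨c, hc, hlow⟩ := aux_poly_lower Q.leadingCoeff (by simpa using hQ)
  choose B hB0 hB using fun i => aux_poly_bound (Q.coeff i)
  set m := Q.natDegree with hm
  set D := ∑ i ∈ Finset.range m, (Q.coeff i).natDegree with hD
  refine ⟨(∑ i ∈ Finset.range m, B i) / c + 1, D, by
    have : 0 ≤ ∑ i ∈ Finset.range m, B i := Finset.sum_nonneg fun i _ => hB0 i
    positivity, ?_⟩
  filter_upwards [hT.eventually hlow, hT.eventually_ge_atTop 1, eventually_ge_atTop 1] with k h1 h2 h3
  have hk : (1:ℝ) ≤ k := by exact_mod_cast h3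
  have hS0 : 0 ≤ ∑ i ∈ Finset.range m, B i := Finset.sum_nonneg fun i _ => hB0 i
  have hTD : (1:ℝ) ≤ T k ^ D := one_le_pow₀ h2
  have e := h k
  rw [Polynomial.eval_eq_sum_range (p := Q), Finset.sum_range_succ, Polynomial.eval_add,
    Polynomial.eval_finsetSum] at e
  simp only [Polynomial.eval_mul, Polynomial.eval_pow, Polynomial.eval_C] at e
  have e2 : |(Q.coeff m).eval (T k) * (k:ℝ) ^ m|
      ≤ ∑ i ∈ Finset.range m, |(Q.coeff i).eval (T k) * (k:ℝ)^i| := by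
    rw [show (Q.coeff m).eval (T k) * (k:ℝ) ^ m
      = -∑ i ∈ Finset.range m, (Q.coeff i).eval (T k) * (k:ℝ)^i by linarith, abs_neg]
    exact Finset.abs_sum_le_sum_abs _ _
  have e3 : c * (k:ℝ) ^ m ≤ |(Q.coeff m).eval (T k) * (k:ℝ) ^ m| := by
    rw [abs_mul, abs_of_nonneg (by positivity : (0:ℝ) ≤ (k:ℝ)^m)]
    gcongr
    exact h1
  have e4 : (∑ i ∈ Finset.range m, |(Q.coeff i).eval (T k) * (k:ℝ)^i|) * k
      ≤ (∑ i ∈ Finset.range m, B i) * T k ^ D * k ^ m := by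
    rw [Finset.sum_mul, Finset.sum_mul, Finset.sum_mul]
    refine Finset.sum_le_sum fun i hi => ?_
    rw [abs_mul, abs_of_nonneg (by positivity : (0:ℝ) ≤ (k:ℝ)^i), mul_assoc, ← pow_succ]
    have hb := hB i D (Finset.single_le_sum (f := fun i => (Q.coeff i).natDegree)
      (fun _ _ => Nat.zero_le _) hi) (T k) h2
    have : (k:ℝ)^(i+1) ≤ (k:ℝ)^m := pow_le_pow_right₀ hk (by have := Finset.mem_range.1 hi; omega)
    gcongr
    exact mul_nonneg (hB0 i) (by positivity)
  have hkm : (0:ℝ) < (k:ℝ)^m := by positivity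
  have e5 : c * k ≤ (∑ i ∈ Finset.range m, B i) * T k ^ D := by
    have : (c * k) * (k:ℝ)^m ≤ ((∑ i ∈ Finset.range m, B i) * T k ^ D) * (k:ℝ)^m := by
      calc (c * k) * (k:ℝ)^m = (c * (k:ℝ)^m) * k := by ring
        _ ≤ (∑ i ∈ Finset.range m, |(Q.coeff i).eval (T k) * (k:ℝ)^i|) * k := by
            gcongr; exact e3.trans e2
        _ ≤ _ := e4
    exact le_of_mul_le_mul_right this hkm
  calc (k:ℝ) ≤ (∑ i ∈ Finset.range m, B i) * T k ^ D / c := by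
        rw [le_div_iff₀ hc]; linarith
    _ ≤ _ := by
        rw [add_mul, div_mul_eq_mul_div]; linarith

lemma aux_sum_ge {n : ℕ} (y : Fin n → ℝ) (d : ℕ) :
    ‖y‖ ^ (2 * d + 2) ≤ ∑ i, y i ^ (2 * d + 2) := by
  have hev : Even (2 * d + 2) := ⟨d + 1, by ring⟩
  rcases isEmpty_or_nonempty (Fin n) with h | h
  · simp [Subsingleton.elim y 0]
  obtain ⟨i, hi⟩ := Finite.exists_max (fun i => ‖y i‖)
  have h1 : ‖y‖ ≤ ‖y i‖ := (pi_norm_le_iff_of_nonneg (norm_nonneg _)).2 hi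
  calc ‖y‖ ^ (2 * d + 2) ≤ ‖y i‖ ^ (2 * d + 2) := by gcongr
    _ = y i ^ (2 * d + 2) := by rw [Real.norm_eq_abs, hev.pow_abs]
    _ ≤ _ := Finset.single_le_sum (f := fun i => y i ^ (2 * d + 2))
        (fun j _ => hev.pow_nonneg _) (Finset.mem_univ i)

lemma aux_maximizers {n : ℕ} (P : MvPolynomial (Fin n) ℝ) :
    ∃ (x : ℕ → Fin n → ℝ), ∀ k : ℕ, ∀ y : Fin n → ℝ,
      (k : ℝ) * MvPolynomial.eval y P - ∑ i, y i ^ (2 * P.totalDegree + 2)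
      ≤ (k : ℝ) * MvPolynomial.eval (x k) P - ∑ i, x k i ^ (2 * P.totalDegree + 2) := by
  obtain ⟨C, hC, hb⟩ := aux_bound P
  set d := P.totalDegree with hd
  suffices ∀ k : ℕ, ∃ x : Fin n → ℝ, ∀ y : Fin n → ℝ,
      (k : ℝ) * MvPolynomial.eval y P - ∑ i, y i ^ (2 * d + 2)
      ≤ (k : ℝ) * MvPolynomial.eval x P - ∑ i, x i ^ (2 * d + 2) by
    choose x hx using this
    exact ⟨x, hx⟩
  intro k
  have hcont : Continuous fun y : Fin n → ℝ =>
      (k : ℝ) * MvPolynomial.eval y P - ∑ i, y i ^ (2 * d + 2) := by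
    have := MvPolynomial.continuous_eval P
    fun_prop
  apply hcont.exists_forall_ge
  have hlin : Tendsto (fun y : Fin n → ℝ => k * C - ‖y‖) (cocompact _) atBot :=
    tendsto_atBot_add_const_left _ _ (tendsto_neg_atTop_atBot.comp (tendsto_norm_cocompact_atTop (E := Fin n → ℝ)))
  refine tendsto_atBot_mono' _ ?_ hlin
  filter_upwards [(tendsto_norm_cocompact_atTop (E := Fin n → ℝ)).eventually_ge_atTop (max 1 (k * C))]
    with y hy
  have h1 : 1 ≤ ‖y‖ := (le_max_left _ _).trans hy
  have h2 : k * C ≤ ‖y‖ := (le_max_right _ _).trans hy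
  have h3 := (le_abs_self _).trans (hb y)
  rw [max_eq_right h1] at h3
  have h4 : ‖y‖ ^ (2 * d + 2) ≤ ∑ i, y i ^ (2 * d + 2) := aux_sum_ge y d
  have h5 : (1:ℝ) ≤ ‖y‖ ^ d := one_le_pow₀ h1
  have h6 : ‖y‖ ^ d * ‖y‖ ≤ ‖y‖ ^ (2 * d + 2) := by
    rw [← pow_succ]; exact pow_le_pow_right₀ h1 (by omega)
  have h7 : (k:ℝ) * MvPolynomial.eval y P ≤ k * (C * ‖y‖ ^ d) := by gcongr
  nlinarith

lemma aux_main {n : ℕ} (P : MvPolynomial (Fin n) ℝ)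
    (hunb : ¬ BddAbove (Set.range fun y : Fin n → ℝ => MvPolynomial.eval y P)) :
    ∃ (K : ℝ) (D : ℕ) (x : ℕ → Fin n → ℝ), 0 < K ∧
      Tendsto (fun k => MvPolynomial.eval (x k) P) atTop atTop ∧
      Tendsto (fun k => ‖x k‖) atTop atTop ∧
      ∀ᶠ k in atTop, ‖x k‖ ≤ K * (MvPolynomial.eval (x k) P) ^ D := by
  classical
  obtain ⟨x, hx⟩ := aux_maximizers P
  obtain ⟨C, hC, hb⟩ := aux_bound P
  set d := P.totalDegree with hd
  have hSnn : ∀ y : Fin n → ℝ, 0 ≤ ∑ i, y i ^ (2 * d + 2) := fun y =>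
    Finset.sum_nonneg fun i _ => Even.pow_nonneg (by exact ⟨d + 1, by ring⟩) _
  have hT : Tendsto (fun k => MvPolynomial.eval (x k) P) atTop atTop := by
    rw [tendsto_atTop]
    intro M
    obtain ⟨_, ⟨y, rfl⟩, hy⟩ := not_bddAbove_iff.1 hunb (M + 1)
    simp only at hy
    filter_upwards [eventually_ge_atTop 1,
      tendsto_natCast_atTop_atTop.eventually_ge_atTop (∑ i, y i ^ (2 * d + 2))] with k h1 h2
    have hk : (1:ℝ) ≤ k := by exact_mod_cast h1
    have := hx k y
    have := hSnn (x k)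
    by_contra! hcon
    nlinarith
  have hN : Tendsto (fun k => ‖x k‖) atTop atTop := by
    rw [tendsto_atTop]
    intro M
    filter_upwards [hT.eventually_gt_atTop (C * (max 1 M) ^ d)] with k hk
    by_contra! hcon
    have := (le_abs_self _).trans (hb (x k))
    have h2 : C * (max 1 ‖x k‖) ^ d ≤ C * (max 1 M) ^ d := by gcongr
    linarith
  -- critical point equations
  have hcrit : ∀ k i, x k i ^ (2 * d + 1) =
      (k : ℝ) * (1 / (2 * d + 2)) * MvPolynomial.eval (x k) (MvPolynomial.pderiv i P) := by
    intro k i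
    set H : MvPolynomial (Fin n) ℝ := MvPolynomial.C (k:ℝ) * P
      - ∑ j, MvPolynomial.X j ^ (2 * d + 2) with hH
    have hev : ∀ y, MvPolynomial.eval y H
        = (k : ℝ) * MvPolynomial.eval y P - ∑ i, y i ^ (2 * d + 2) := by
      intro y; simp [hH]
    have hder := aux_hasDerivAt H (x k) i (x k i)
    have hmax : IsLocalMax (fun τ => MvPolynomial.eval (Function.update (x k) i τ) H) (x k i) := by
      refine Eventually.of_forall fun τ => ?_
      simp only [Function.update_eq_self, hev]
      exact hx k _
    have h0 := hmax.hasDerivAt_eq_zero hder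
    rw [Function.update_eq_self] at h0
    have hp : MvPolynomial.eval (x k) (MvPolynomial.pderiv i H) =
        k * MvPolynomial.eval (x k) (MvPolynomial.pderiv i P) - (2 * d + 2) * x k i ^ (2 * d + 1) := by
      simp [hH, MvPolynomial.pderiv_pow, MvPolynomial.pderiv_X, Pi.single_apply]
    rw [hp] at h0
    have : (2 * (d:ℝ) + 2) ≠ 0 := by positivity
    field_simp
    linarith
  -- integrality
  letI : Algebra (Polynomial ℝ) (ℕ → ℝ) :=
    (Polynomial.aeval (R := ℝ) (fun k : ℕ => (k : ℝ))).toRingHom.toAlgebra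
  have halg : ∀ (f : Polynomial ℝ) (k : ℕ), algebraMap (Polynomial ℝ) (ℕ → ℝ) f k = f.eval (k:ℝ) := by
    intro f k
    change (Polynomial.aeval (R := ℝ) (fun k : ℕ => (k : ℝ))) f k = _
    have := Polynomial.aeval_algHom_apply (Pi.evalAlgHom ℝ (fun _ : ℕ => ℝ) k) (fun k : ℕ => (k : ℝ)) f
    simp only [Pi.evalAlgHom_apply] at this
    rw [← this, Polynomial.coe_aeval_eq_eval]
  have hmap : ∀ (G : MvPolynomial (Fin n) ℝ) (k : ℕ),
      MvPolynomial.aeval (R := Polynomial ℝ) (fun i k => x k i)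
        (MvPolynomial.map Polynomial.C G) k = MvPolynomial.eval (x k) G := by
    intro G k
    induction G using MvPolynomial.induction_on with
    | C a => simp [halg]
    | add p q hp hq => simp [hp, hq]
    | mul_X p j hp => simp [hp]
  have hQint : IsIntegral (Polynomial ℝ) (MvPolynomial.aeval (R := Polynomial ℝ)
      (fun i k => x k i : Fin n → ℕ → ℝ) (MvPolynomial.map Polynomial.C P)) := by
    refine aux_integral (m := 2 * d + 1) _ (fun i => MvPolynomial.C (Polynomial.X * Polynomial.C (1 / (2 * (d:ℝ) + 2))) *
      MvPolynomial.map Polynomial.C (MvPolynomial.pderiv i P)) ?_ ?_ _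
    · intro i
      have h1 := aux_pderiv_deg P i
      have h2 := MvPolynomial.totalDegree_mul (MvPolynomial.C (σ := Fin n) (Polynomial.X * Polynomial.C (1 / (2 * (d:ℝ) + 2))))
        (MvPolynomial.map Polynomial.C (MvPolynomial.pderiv i P))
      have h3 : (MvPolynomial.map (Polynomial.C) (MvPolynomial.pderiv i P)).totalDegree
        ≤ (MvPolynomial.pderiv i P).totalDegree :=
          Finset.sup_mono (MvPolynomial.support_map_subset _ _)
      rw [MvPolynomial.totalDegree_C] at h2
      omega
    · intro i
      funext k
      rw [map_mul, Pi.mul_apply, hmap, MvPolynomial.aeval_C, halg]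
      simpa [mul_comm ((2 * (d:ℝ) + 2)⁻¹)] using hcrit k i
  obtain ⟨Q, hQm, hQ⟩ := hQint
  have hQ' : ∀ k : ℕ, Polynomial.aevalAeval (k:ℝ) (MvPolynomial.eval (x k) P) Q = 0 := by
    intro k
    have := congrFun hQ k
    rw [Polynomial.eval₂_eq_sum_range, Finset.sum_apply] at this
    simp only [Pi.mul_apply, Pi.pow_apply, hmap, halg, Pi.zero_apply] at this
    rw [← this]
    conv_lhs => rw [Q.as_sum_range_C_mul_X_pow]
    simp [Polynomial.aevalAeval]
  have hgr := aux_growth (Polynomial.Bivariate.swap Q)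
    ((map_ne_zero_iff _ Polynomial.Bivariate.swap.injective).2 hQm.ne_zero)
    (fun k => MvPolynomial.eval (x k) P) hT (by
      intro k
      rw [← hQ' k, ← Polynomial.Bivariate.aevalAeval_swap]
      generalize Polynomial.Bivariate.swap Q = Q1
      conv_lhs => rw [Q1.as_sum_range_C_mul_X_pow]
      conv_rhs => rw [Q1.as_sum_range_C_mul_X_pow]
      simp [Polynomial.aevalAeval, Polynomial.eval_finsetSum])
  obtain ⟨K, D, hK, hKD⟩ := hgr
  refine ⟨(C + |MvPolynomial.eval 0 P|) * K, D, x, by positivity, hT, hN, ?_⟩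
  filter_upwards [hKD, hN.eventually_ge_atTop 1] with k h1 h2
  have h0 := hx k 0
  have h3 := (le_abs_self _).trans (hb (x k))
  rw [max_eq_right h2] at h3
  have h4 : ‖x k‖ ^ (2 * d + 2) ≤ ∑ i, x k i ^ (2 * d + 2) := aux_sum_ge (x k) d
  have h5 : (1:ℝ) ≤ ‖x k‖ ^ d := one_le_pow₀ h2
  have h6 : ‖x k‖ ^ d * ‖x k‖ ≤ ‖x k‖ ^ (2 * d + 2) := by
    rw [← pow_succ]; exact pow_le_pow_right₀ h2 (by omega)
  have h7 : ∑ i, (0 : Fin n → ℝ) i ^ (2 * d + 2) = 0 := by simp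
  rw [h7] at h0
  have h8 : ‖x k‖ ^ d * ‖x k‖ ≤ ‖x k‖ ^ d * ((C + |MvPolynomial.eval 0 P|) * k) := by
    have ha : -|MvPolynomial.eval 0 P| ≤ MvPolynomial.eval 0 P := neg_abs_le _
    have hb' : (k:ℝ) * MvPolynomial.eval (x k) P ≤ k * (C * ‖x k‖ ^ d) := by gcongr
    have hc' : (k:ℝ) * -|MvPolynomial.eval 0 P| ≤ k * MvPolynomial.eval 0 P := by gcongr
    have hd' : (k:ℝ) * |MvPolynomial.eval 0 P| * 1 ≤ (k:ℝ) * |MvPolynomial.eval 0 P| * ‖x k‖ ^ d := by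
      gcongr
    nlinarith
  have h9 := le_of_mul_le_mul_left h8 (by positivity)
  calc ‖x k‖ ≤ _ := h9
    _ ≤ (C + |MvPolynomial.eval 0 P|) * (K * MvPolynomial.eval (x k) P ^ D) := by gcongr
    _ = _ := by ring

lemma aux_part1 {n : ℕ} (P : MvPolynomial (Fin n) ℝ) (s C R : ℝ)
    (x : ℕ → EuclideanSpace ℝ (Fin n)) (hs : 0 < s) (hC : 0 < C)
    (hI : Integrable (fun y : EuclideanSpace ℝ (Fin n) =>
        Real.exp (MvPolynomial.eval (fun i => y i) P)))
    (hx : Tendsto (fun k => ‖x k‖) atTop atTop)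
    (hxs : ∀ k, ‖x k‖ ^ s ≤ MvPolynomial.eval (fun i => x k i) P)
    (hgrad : ∀ y : EuclideanSpace ℝ (Fin n), R ≤ ‖y‖ →
        ‖fderiv ℝ (fun z : EuclideanSpace ℝ (Fin n) =>
            MvPolynomial.eval (fun i => z i) P) y‖ ≤ C * ‖y‖ ^ (n - 2)) : False := by
  set p : EuclideanSpace ℝ (Fin n) → ℝ := fun z => MvPolynomial.eval (fun i => z i) P with hp
  have hdiff : Differentiable ℝ p := by
    have hh : ∀ Q : MvPolynomial (Fin n) ℝ, Differentiable ℝ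
        (fun z : EuclideanSpace ℝ (Fin n) => MvPolynomial.eval (fun i => z i) Q) := by
      intro Q
      induction Q using MvPolynomial.induction_on with
      | C a => simp
      | add p q hp hq => simp only [map_add]; exact hp.add hq
      | mul_X p j hp => 
        simp only [map_mul, MvPolynomial.eval_X]
        exact hp.mul (by fun_prop)
    exact hh P
  set V : ℝ := volume.real (Metric.ball (0 : EuclideanSpace ℝ (Fin n)) 1) with hV
  have hVpos : 0 < V := by
    rw [hV, measureReal_def]
    exact ENNReal.toReal_pos (Metric.measure_ball_pos _ _ one_pos).ne' measure_ball_lt_top.ne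
  set I : ℝ := ∫ y, Real.exp (p y) with hIdef
  set m := n - 2 with hm
  have hIV : ∀ᶠ k in atTop, Real.exp (‖x k‖ ^ s) / ‖x k‖ ^ (m * n) ≤ I * Real.exp (C * 2 ^ m) / V := by
    filter_upwards [hx.eventually_ge_atTop 1, hx.eventually_ge_atTop (R + 1)] with k h1 h2
    set r := ‖x k‖ with hr
    have hrm : 1 ≤ r ^ m := one_le_pow₀ h1
    set ρ : ℝ := (r ^ m)⁻¹ with hρ
    have hρ0 : 0 < ρ := by positivity
    have hρ1 : ρ ≤ 1 := inv_le_one_of_one_le₀ hrm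
    have hlow : Metric.ball (x k) ρ ⊆ {y | Real.exp (r ^ s - C * 2 ^ m) ≤ Real.exp (p y)} := by
      intro y hy
      have hmv := Convex.norm_image_sub_le_of_norm_fderiv_le (𝕜 := ℝ) (f := p) (C := C * (2 * r) ^ m)
        (s := Metric.ball (x k) ρ) (fun z _ => hdiff z) (fun z hz => ?_) (convex_ball _ _)
        (Metric.mem_ball_self hρ0) hy
      · simp only [Set.mem_ofPred_eq, Real.exp_le_exp]
        have hy' : ‖y - x k‖ ≤ ρ := (mem_ball_iff_norm.1 hy).le
        have : C * (2 * r) ^ m * ‖y - x k‖ ≤ C * (2 * r) ^ m * ρ := by gcongr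
        have h3 : C * (2 * r) ^ m * ρ = C * 2 ^ m := by
          rw [hρ, mul_pow]; field_simp
        have h4 := neg_abs_le (p y - p (x k))
        rw [Real.norm_eq_abs] at hmv
        have h5 := hxs k
        change r ^ s ≤ p (x k) at h5
        linarith
      · have hz' : ‖z - x k‖ < ρ := mem_ball_iff_norm.1 hz
        have ha : ‖z‖ ≤ 2 * r := by
          have := norm_le_norm_add_norm_sub' z (x k)
          linarith
        have hb : R ≤ ‖z‖ := by
          have := norm_le_norm_add_norm_sub' (x k) z
          rw [norm_sub_rev] at this
          linarith
        refine (hgrad z hb).trans ?_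
        gcongr
    have hM := mul_meas_ge_le_integral_of_nonneg (μ := volume)
      (f := fun y => Real.exp (p y)) (Eventually.of_forall fun y => (Real.exp_pos _).le) hI
      (Real.exp (r ^ s - C * 2 ^ m))
    have hfin : volume {y | Real.exp (r ^ s - C * 2 ^ m) ≤ Real.exp (p y)} ≠ ⊤ := 
      (hI.measure_ge_lt_top (Real.exp_pos _)).ne
    have hball : volume.real (Metric.ball (x k) ρ) = ρ ^ n * V := by
      rw [hV, measureReal_def, Measure.addHaar_ball_of_pos _ _ hρ0, ENNReal.toReal_mul,
        ENNReal.toReal_ofReal (by positivity), measureReal_def]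
      simp
    have hle : ρ ^ n * V ≤ volume.real {y | Real.exp (r ^ s - C * 2 ^ m) ≤ Real.exp (p y)} := by
      rw [← hball]; exact measureReal_mono hlow hfin
    have h6 : Real.exp (r ^ s - C * 2 ^ m) * (ρ ^ n * V) ≤ I :=
      (mul_le_mul_of_nonneg_left hle (Real.exp_pos _).le).trans hM
    rw [Real.exp_sub, hρ, inv_pow, ← pow_mul] at h6
    rw [le_div_iff₀ hVpos]
    have hE := Real.exp_pos (C * 2 ^ m)
    calc Real.exp (r ^ s) / r ^ (m * n) * V
        = (Real.exp (r ^ s) / Real.exp (C * 2 ^ m) * ((r ^ (m * n))⁻¹ * V)) * Real.exp (C * 2 ^ m) := by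
          field_simp
      _ ≤ I * Real.exp (C * 2 ^ m) := by gcongr
  have hinf : Tendsto (fun k => Real.exp (‖x k‖ ^ s) / ‖x k‖ ^ (m * n)) atTop atTop := by
    have h := (tendsto_exp_div_rpow_atTop ((m * n : ℕ) / s)).comp ((tendsto_rpow_atTop hs).comp hx)
    refine h.congr fun k => ?_
    simp only [Function.comp]
    rw [← Real.rpow_mul (norm_nonneg _), mul_div_cancel₀ _ hs.ne', Real.rpow_natCast]
  obtain ⟨k, h1, h2⟩ := (hIV.and (hinf.eventually_gt_atTop _)).exists
  linarith

theorem stmt_8 {n : ℕ} (hn : 3 ≤ n) :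
    (¬ ∃ (P : MvPolynomial (Fin n) ℝ) (s C R : ℝ)
        (x : ℕ → EuclideanSpace ℝ (Fin n)),
      0 < s ∧ 0 < C ∧
      Integrable (fun y : EuclideanSpace ℝ (Fin n) =>
        Real.exp (MvPolynomial.eval (fun i => y i) P)) ∧
      Tendsto (fun k => ‖x k‖) atTop atTop ∧
      (∀ k, ‖x k‖ ^ s ≤ MvPolynomial.eval (fun i => x k i) P) ∧
      (∀ y : EuclideanSpace ℝ (Fin n), R ≤ ‖y‖ →
        ‖fderiv ℝ (fun z : EuclideanSpace ℝ (Fin n) =>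
            MvPolynomial.eval (fun i => z i) P) y‖ ≤ C * ‖y‖ ^ (n - 2))) ∧
    (∀ (P : MvPolynomial (Fin n) ℝ) (C R : ℝ),
      P.totalDegree ≤ n - 1 →
      (∀ y : EuclideanSpace ℝ (Fin n), R ≤ ‖y‖ →
        ‖fderiv ℝ (fun z : EuclideanSpace ℝ (Fin n) =>
            MvPolynomial.eval (fun i => z i) P) y‖ ≤ C * ‖y‖ ^ (n - 2)) →
      Integrable (fun y : EuclideanSpace ℝ (Fin n) =>
        Real.exp (MvPolynomial.eval (fun i => y i) P)) →
      BddAbove (Set.range fun y : EuclideanSpace ℝ (Fin n) =>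
        MvPolynomial.eval (fun i => y i) P)) := by
  refine ⟨?_, ?_⟩
  · rintro ⟨P, s, C, R, x, hs, hC, hI, hx, hxs, hg⟩
    exact aux_part1 P s C R x hs hC hI hx hxs hg
  intro P C R _ hg hI
  by_contra hunb
  have hunb' : ¬ BddAbove (Set.range fun y : Fin n → ℝ => MvPolynomial.eval y P) := by
    rintro ⟨M, hM⟩
    refine hunb ⟨M, ?_⟩
    rintro _ ⟨y, rfl⟩
    exact hM ⟨_, rfl⟩
  obtain ⟨K, D, x, hK, hT, hN, hKD⟩ := aux_main P hunb'
  have hsup : ∀ y : Fin n → ℝ, ‖y‖ ≤ ‖(WithLp.toLp 2 y : EuclideanSpace ℝ (Fin n))‖ := by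
    intro y
    refine (pi_norm_le_iff_of_nonneg (norm_nonneg _)).2 fun i => ?_
    exact PiLp.norm_apply_le (WithLp.toLp 2 y : EuclideanSpace ℝ (Fin n)) i
  have hsup2 : ∀ y : Fin n → ℝ, ‖(WithLp.toLp 2 y : EuclideanSpace ℝ (Fin n))‖ ≤ n * ‖y‖ := by
    intro y
    rw [EuclideanSpace.norm_eq]
    refine Real.sqrt_le_iff.2 ⟨by positivity, ?_⟩
    calc ∑ i, ‖y i‖ ^ 2 ≤ ∑ _i : Fin n, ‖y‖ ^ 2 := by
          refine Finset.sum_le_sum fun i _ => ?_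
          gcongr
          exact norm_le_pi_norm y i
      _ = n * ‖y‖ ^ 2 := by simp
      _ ≤ (n * ‖y‖) ^ 2 := by
          rw [mul_pow]
          have : (1:ℝ) ≤ n := by exact_mod_cast (by omega : 1 ≤ n)
          gcongr
          nlinarith
  obtain ⟨k₀, hk₀⟩ := eventually_atTop.1 (hKD.and (hT.eventually_ge_atTop (max 1 (n * K))))
  refine aux_part1 P (1 / ((D + 1 : ℕ) : ℝ)) (|C| + 1) R (fun k => WithLp.toLp 2 (x (k + k₀))) (by positivity)
    (by positivity) hI ?_ ?_ ?_
  · exact tendsto_atTop_mono (fun k => hsup _) (hN.comp (tendsto_add_atTop_nat k₀))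
  · intro k
    obtain ⟨h1, h2⟩ := hk₀ (k + k₀) (by omega)
    set T := MvPolynomial.eval (x (k + k₀)) P with hTdef
    change ‖(WithLp.toLp 2 (x (k + k₀)) : EuclideanSpace ℝ (Fin n))‖ ^ _ ≤ T
    have hT1 : 1 ≤ T := (le_max_left _ _).trans h2
    have hTK : n * K ≤ T := (le_max_right _ _).trans h2
    have h3 : ‖(WithLp.toLp 2 (x (k + k₀)) : EuclideanSpace ℝ (Fin n))‖ ≤ T ^ (D + 1) := by
      calc _ ≤ n * ‖x (k + k₀)‖ := hsup2 _
        _ ≤ n * (K * T ^ D) := by gcongr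
        _ = (n * K) * T ^ D := by ring
        _ ≤ T * T ^ D := by gcongr
        _ = _ := by ring
    calc _ ≤ (T ^ (D + 1)) ^ (1 / ((D + 1 : ℕ) : ℝ)) :=
          Real.rpow_le_rpow (norm_nonneg _) h3 (by positivity)
      _ = T := by
          rw [one_div]
          exact Real.pow_rpow_inv_natCast (by linarith) (by omega)
  · intro y hy
    refine (hg y hy).trans ?_
    gcongr
    linarith [le_abs_self C]
end
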